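/- For m ≥ 5 alternatives and odd n ≥ 5 voters, there is no even-chance SDS on strict preference profiles that simultaneously satisfies weak strategyproofness, Condorcet-consistency, and ex post efficiency. -/

import Mathlib

open Classical Finset

structure StrictPref (A : Type*) where
  rel : A → A → Prop
  trans : ∀ {a b c}, rel a b → rel b c → rel a c
  irrefl : ∀ a, ¬ rel a a
  total : ∀ a b, a ≠ b → rel a b ∨ rel b a

variable {A V : Type*} [Fintype A] [Fintype V]

/-- Probability assigned by `p` to the upper contour set of `x` w.r.t. strict relation `r`. -/
noncomputable def probUC (p : A → ℝ) (r : A → A → Prop) (x : A) : ℝ :=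
  ∑ y ∈ Finset.univ.filter (fun y => y = x ∨ r y x), p y

/-- `p` (weakly) stochastically dominates `q` w.r.t. `r`. -/
def SD (r : A → A → Prop) (p q : A → ℝ) : Prop :=
  ∀ x, probUC q r x ≤ probUC p r x

/-- `p` strictly stochastically dominates `q` w.r.t. `r`. -/
def StrictSD (r : A → A → Prop) (p q : A → ℝ) : Prop :=
  SD r p q ∧ ∃ x, probUC q r x < probUC p r x

def IsLottery (p : A → ℝ) : Prop := (∀ a, 0 ≤ p a) ∧ ∑ a, p a = 1

/-- Weak strategyproofness of a social decision scheme on strict profiles. -/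
def WeakSP (f : (V → StrictPref A) → A → ℝ) : Prop :=
  ∀ R R' : V → StrictPref A, ∀ i : V,
    (∀ j, j ≠ i → R j = R' j) → ¬ StrictSD (R i).rel (f R') (f R)

def IsTopOf (r : A → A → Prop) (x : A) : Prop := ∀ y, y ≠ x → r x y

noncomputable def unif (X : Finset A) : A → ℝ :=
  fun x => if x ∈ X then 1 / (X.card : ℝ) else 0

def EvenChance (f : (V → StrictPref A) → A → ℝ) : Prop :=
  ∀ R, ∃ X : Finset A, X.Nonempty ∧ f R = unif X

def CondorcetWinner (R : V → StrictPref A) (x : A) : Prop :=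
  ∀ y, y ≠ x →
    (Finset.univ.filter (fun i => (R i).rel y x)).card <
      (Finset.univ.filter (fun i => (R i).rel x y)).card

def ExPostEfficient (f : (V → StrictPref A) → A → ℝ) : Prop :=
  ∀ (R : V → StrictPref A) (x : A), (∃ y, ∀ i, (R i).rel y x) → f R x = 0

namespace EvenChance

/-- A ballot over the five core alternatives, listed from best to worst. -/
abbrev Ballot := List (Fin 5)

/-- `x` comes before `y` on the ballot; unlisted alternatives come last, in increasing order. -/
def prefers (r : Ballot) (x y : ℕ) : Bool :=
  (r.map Fin.val).idxOf x < (r.map Fin.val).idxOf y ||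
    ((r.map Fin.val).idxOf x == (r.map Fin.val).idxOf y && decide (x < y))

theorem prefers_iff {r : Ballot} {x y : ℕ} :
    prefers r x y = true ↔ (r.map Fin.val).idxOf x < (r.map Fin.val).idxOf y ∨
      (r.map Fin.val).idxOf x = (r.map Fin.val).idxOf y ∧ x < y := by
  simp [prefers]

/-- Every core alternative is preferred to every other alternative. -/
theorem prefers_of_lt_of_le (r : Ballot) {x y : ℕ} (hx : x < 5) (hy : 5 ≤ y) :
    prefers r x y = true := by
  have hy' : y ∉ r.map Fin.val := by
    simp only [List.mem_map, not_exists, not_and]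
    intro a _ h
    omega
  have h₁ := List.idxOf_eq_length_iff.2 hy'
  have h₂ : (r.map Fin.val).idxOf x ≤ (r.map Fin.val).length := List.idxOf_le_length
  rw [prefers_iff]
  omega

/-- The strict preference relation on `Fin m` described by a ballot. -/
def Ballot.toStrictPref (m : ℕ) (r : Ballot) : StrictPref (Fin m) where
  rel x y := prefers r x y = true
  trans := by
    intro a b c
    simp only [prefers_iff]
    omega
  irrefl := by
    intro a
    simp only [prefers_iff]
    omega
  total := by
    intro a b hab
    have := Fin.val_ne_of_ne hab
    simp only [prefers_iff]
    omega

/-- The number of elements of `X` that are weakly preferred to `x`. -/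
def upperCount (r : Ballot) (X : List (Fin 5)) (x : Fin 5) : ℕ :=
  X.countP fun y : Fin 5 => y == x || prefers r y x

/-- Whether the uniform lottery over `Y` strictly stochastically dominates the one over `X`. -/
def dominates (r : Ballot) (Y X : List (Fin 5)) : Bool :=
  ((List.finRange 5).all fun x =>
      upperCount r X x * Y.length ≤ upperCount r Y x * X.length) &&
    (List.finRange 5).any fun x =>
      upperCount r X x * Y.length < upperCount r Y x * X.length

/-- Whether no voter profits from exchanging the ballots `r` and `s` when these lead to the
uniform lotteries over `X` and `Y`, respectively. -/
def compatible (r s : Ballot) (X Y : List (Fin 5)) : Bool :=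
  !dominates r Y X && !dominates s X Y

/-- The possible supports of an even-chance lottery over the core alternatives. -/
def supports : List (List (Fin 5)) :=
  (List.finRange 5).sublists.filter fun X => !X.isEmpty

/-- The ballots of seven classes of voters. The first five classes consist of one voter each; the
last two are equally large. -/
abbrev Blocks := Fin 7 → Ballot

/-- Whether all voters prefer `y` to `x`. -/
def unanimous (B : Blocks) (y x : Fin 5) : Bool :=
  (List.finRange 7).all fun c => prefers (B c) y x

/-- A sufficient condition for a majority to prefer `x` to `y`: this is so among the first five
voters, and the other two classes do not upset it. -/
def beats (B : Blocks) (x y : Fin 5) : Bool :=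
  decide (∑ c : Fin 5, (prefers (B (c.castAdd 2)) y x).toNat <
      ∑ c : Fin 5, (prefers (B (c.castAdd 2)) x y).toNat) &&
    decide (∑ c : Fin 2, (prefers (B (c.natAdd 5)) y x).toNat ≤
      ∑ c : Fin 2, (prefers (B (c.natAdd 5)) x y).toNat)

/-- Whether `x` is recognised as Condorcet winner by `beats`. -/
def condorcet (B : Blocks) (x : Fin 5) : Bool :=
  (List.finRange 5).all fun y : Fin 5 => (y.val == x.val) || beats B x y

/-- Whether Condorcet-consistency or ex post efficiency rule out the support `X`. -/
def inadmissible (B : Blocks) (X : List (Fin 5)) : Bool :=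
  ((List.finRange 5).any fun x : Fin 5 => condorcet B x && X != [x]) ||
    X.any fun x => (List.finRange 5).any fun y : Fin 5 => unanimous B y x

/-- Whether `X` respects ex post efficiency at profiles in which the voters of one class cast
either their ballot in `B` or `T`. -/
def efficient (B : Blocks) (T : Ballot) (X : List (Fin 5)) : Bool :=
  X.all fun x => (List.finRange 5).all fun y : Fin 5 => !(unanimous B y x && prefers T y x)

/-- The supports possible after one voter switched from `r` to `T`, starting from a member
of `C`. -/
def successors (r T : Ballot) (C : List (List (Fin 5))) : List (List (Fin 5)) :=
  supports.filter fun Y => C.any fun X => compatible r T X Y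

/-- Whether `C` is invariant under single voters of class `c` switching to `T`. -/
def invariant (B : Blocks) (c : Fin 7) (T : Ballot) (C : List (List (Fin 5))) : Bool :=
  (successors (B c) T C).all fun Y => C.contains Y || !efficient B T Y

/-- Derivation that an outcome is impossible: either it is inadmissible, or all outcomes that
might result once the voters of class `c` switch to `T` are impossible. -/
inductive Refutation
  | leaf
  | move (c : Fin 7) (T : Ballot) (next : List (Fin 5) → Refutation)

/-- Soundness check for a move of class `c`: a single voter moves to one of the successors, a
whole class stays within an invariant collection of supports. -/
def Refutation.check : Refutation → Blocks → List (Fin 5) → Bool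
  | leaf, B, X => inadmissible B X
  | move c T next, B, X =>
    if c.val < 5 then
      (successors (B c) T [X]).all fun Y => (next Y).check (Function.update B c T) Y
    else
      let C := (fun C => C ++ (successors (B c) T C).filter
        fun Y => !C.contains Y && efficient B T Y)^[5] [X]
      invariant B c T C && C.all fun Y => (next Y).check (Function.update B c T) Y

theorem mem_supports {X : List (Fin 5)} :
    X ∈ supports ↔ X.Sublist (List.finRange 5) ∧ X ≠ [] := by
  simp [supports]

theorem nodup_of_mem_supports {X : List (Fin 5)} (hX : X ∈ supports) : X.Nodup :=
  (mem_supports.1 hX).1.nodup (List.nodup_finRange 5)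

/-- The core alternatives in `X`, as alternatives in `Fin m`. -/
def coreSet {m : ℕ} (hm : 5 ≤ m) (X : List (Fin 5)) : Finset (Fin m) :=
  (X.map (Fin.castLE hm)).toFinset

section Lotteries

variable {m : ℕ} (hm : 5 ≤ m)

theorem mem_coreSet {X : List (Fin 5)} {z : Fin m} :
    z ∈ coreSet hm X ↔ ∃ x ∈ X, Fin.castLE hm x = z := by
  simp [coreSet]

theorem castLE_mem_coreSet {X : List (Fin 5)} {x : Fin 5} :
    Fin.castLE hm x ∈ coreSet hm X ↔ x ∈ X := by
  simp [mem_coreSet, Fin.castLE_inj]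

theorem card_coreSet {X : List (Fin 5)} (hX : X.Nodup) : (coreSet hm X).card = X.length := by
  rw [coreSet, List.toFinset_card_of_nodup (hX.map (Fin.castLE_injective hm)), List.length_map]

theorem probUC_unif {A : Type*} [Fintype A] {X S : Finset A} {r : A → A → Prop} {x : A}
    (hS : ∀ y, y ∈ S ↔ y ∈ X ∧ (y = x ∨ r y x)) :
    probUC (unif X) r x = (S.card : ℝ) / X.card := by
  have h : (Finset.univ.filter fun y => y = x ∨ r y x).filter (fun y => y ∈ X) = S := by
    ext y
    simp [hS, and_comm]
  simp only [probUC, unif]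
  rw [← Finset.sum_filter, h, Finset.sum_const, nsmul_eq_mul, mul_one_div]

theorem probUC_coreSet_castLE {X : List (Fin 5)} (hX : X.Nodup) (r : Ballot) (x : Fin 5) :
    probUC (unif (coreSet hm X)) (r.toStrictPref m).rel (Fin.castLE hm x) =
      (upperCount r X x : ℝ) / X.length := by
  have h : ∀ z, z ∈ coreSet hm (X.filter fun y : Fin 5 => y == x || prefers r y x) ↔
      z ∈ coreSet hm X ∧
        (z = Fin.castLE hm x ∨ (r.toStrictPref m).rel z (Fin.castLE hm x)) := by
    intro z
    simp only [mem_coreSet, List.mem_filter]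
    constructor
    · rintro ⟨y, ⟨hy, h⟩, rfl⟩
      refine ⟨⟨y, hy, rfl⟩, ?_⟩
      simpa [Fin.castLE_inj, Ballot.toStrictPref] using h
    · rintro ⟨⟨y, hy, rfl⟩, h⟩
      refine ⟨y, ⟨hy, ?_⟩, rfl⟩
      simpa [Fin.castLE_inj, Ballot.toStrictPref] using h
  rw [probUC_unif h, card_coreSet hm hX, card_coreSet hm (hX.filter _), upperCount,
    List.countP_eq_length_filter]

theorem probUC_coreSet_of_le {X : List (Fin 5)} (hX : X ∈ supports) (r : Ballot) {z : Fin m}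
    (hz : 5 ≤ z.val) : probUC (unif (coreSet hm X)) (r.toStrictPref m).rel z = 1 := by
  rw [probUC_unif (S := coreSet hm X), card_coreSet hm (nodup_of_mem_supports hX)]
  · exact div_self (Nat.cast_ne_zero.2 (List.length_pos_iff.2 (mem_supports.1 hX).2).ne')
  · refine fun y => ⟨fun hy => ⟨hy, ?_⟩, And.left⟩
    obtain ⟨x, -, rfl⟩ := (mem_coreSet hm).1 hy
    exact Or.inr (prefers_of_lt_of_le r x.isLt hz)

theorem strictSD_of_dominates {r : Ballot} {X Y : List (Fin 5)} (hX : X ∈ supports)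
    (hY : Y ∈ supports) (h : dominates r Y X = true) :
    StrictSD (r.toStrictPref m).rel (unif (coreSet hm Y)) (unif (coreSet hm X)) := by
  simp only [dominates, Bool.and_eq_true, List.all_eq_true, List.any_eq_true, decide_eq_true_eq,
    List.mem_finRange, true_and, forall_const] at h
  obtain ⟨h, x, hx⟩ := h
  have hX₀ : (0 : ℝ) < X.length := Nat.cast_pos.2 (List.length_pos_iff.2 (mem_supports.1 hX).2)
  have hY₀ : (0 : ℝ) < Y.length := Nat.cast_pos.2 (List.length_pos_iff.2 (mem_supports.1 hY).2)
  refine ⟨fun z => ?_, Fin.castLE hm x, ?_⟩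
  · rcases lt_or_ge z.val 5 with hz | hz
    · rw [show z = Fin.castLE hm ⟨z, hz⟩ from rfl,
        probUC_coreSet_castLE hm (nodup_of_mem_supports hX),
        probUC_coreSet_castLE hm (nodup_of_mem_supports hY), div_le_div_iff₀ hX₀ hY₀]
      exact_mod_cast h _
    · rw [probUC_coreSet_of_le hm hX r hz, probUC_coreSet_of_le hm hY r hz]
  · rw [probUC_coreSet_castLE hm (nodup_of_mem_supports hX),
      probUC_coreSet_castLE hm (nodup_of_mem_supports hY), div_lt_div_iff₀ hX₀ hY₀]
    exact_mod_cast hx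

end Lotteries

/-- An even-chance, weakly strategyproof, ex post efficient and Condorcet-consistent rule. -/
structure IsDesirable {V : Type*} [Fintype V] {m : ℕ}
    (f : (V → StrictPref (Fin m)) → Fin m → ℝ) : Prop where
  evenChance : EvenChance f
  weakSP : WeakSP f
  exPost : ExPostEfficient f
  condorcet : ∀ R x, CondorcetWinner R x → f R x = 1

/-- The profile in which the voters cast the given ballots. -/
def profile (m : ℕ) {V : Type*} (g : V → Ballot) (i : V) : StrictPref (Fin m) :=
  (g i).toStrictPref m

section Soundness

variable {V : Type*} [Fintype V] {m : ℕ} (hm : 5 ≤ m)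
  {f : (V → StrictPref (Fin m)) → Fin m → ℝ}

theorem exists_support (hf : IsDesirable f) (g : V → Ballot) :
    ∃ X ∈ supports, f (profile m g) = unif (coreSet hm X) ∧
      ∀ x ∈ X, ∀ y : Fin 5, ∃ i, prefers (g i) y x = false := by
  obtain ⟨S, ⟨s, hs⟩, h⟩ := hf.evenChance (profile m g)
  have hne : ∀ z ∈ S, ∀ y, ¬ ∀ i, (profile m g i).rel y z := by
    intro z hz y hy
    have := hf.exPost (profile m g) z ⟨y, hy⟩
    rw [h, unif, if_pos hz] at this
    have hS : (S.card : ℝ) ≠ 0 := Nat.cast_ne_zero.2 (Finset.card_ne_zero_of_mem hz)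
    exact one_div_ne_zero hS this
  have hlt : ∀ z ∈ S, z.val < 5 := by
    intro z hz
    by_contra hz5
    exact hne z hz (Fin.castLE hm 0) fun i =>
      prefers_of_lt_of_le (g i) (by simp) (not_lt.1 hz5)
  have hmem : ∀ x : Fin 5,
      x ∈ (List.finRange 5).filter (fun x => decide (Fin.castLE hm x ∈ S)) ↔
        Fin.castLE hm x ∈ S := by
    simp
  refine ⟨_, mem_supports.2 ⟨List.filter_sublist, List.ne_nil_of_mem ((hmem ⟨s, hlt s hs⟩).2 hs)⟩,
    ?_, fun x hx y => ?_⟩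
  · rw [h]
    congr 1
    ext z
    rw [mem_coreSet]
    constructor
    · exact fun hz => ⟨⟨z, hlt z hz⟩, (hmem _).2 hz, rfl⟩
    · rintro ⟨x, hx, rfl⟩
      exact (hmem x).1 hx
  · by_contra! hy
    exact hne _ ((hmem x).1 hx) (Fin.castLE hm y) fun i => (Bool.not_eq_false _).mp (hy i)

theorem compatible_of_eq_off (hf : IsDesirable f) {g g' : V → Ballot} {i : V}
    (hg : ∀ j, j ≠ i → g j = g' j) {X Y : List (Fin 5)} (hX : X ∈ supports) (hY : Y ∈ supports)
    (hfX : f (profile m g) = unif (coreSet hm X))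
    (hfY : f (profile m g') = unif (coreSet hm Y)) : compatible (g i) (g' i) X Y = true := by
  simp only [compatible, Bool.and_eq_true, Bool.not_eq_true', ← Bool.not_eq_true]
  constructor <;> intro h
  · refine hf.weakSP (profile m g) (profile m g') i (fun j hj => ?_) ?_
    · simp only [profile, hg j hj]
    · rw [hfX, hfY]
      exact strictSD_of_dominates hm hX hY h
  · refine hf.weakSP (profile m g') (profile m g) i (fun j hj => ?_) ?_
    · simp only [profile, hg j hj]
    · rw [hfX, hfY]
      exact strictSD_of_dominates hm hY hX h

variable {cls : V → Fin 7} {k : ℕ}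

theorem card_prefers
    (hcls : ∀ c, (Finset.univ.filter fun i => cls i = c).card = if c.val < 5 then 1 else k)
    (B : Blocks) (x y : Fin 5) {S : Finset V}
    (hS : ∀ i, i ∈ S ↔ prefers (B (cls i)) x y = true) :
    S.card = ∑ c : Fin 5, (prefers (B (c.castAdd 2)) x y).toNat +
      k * ∑ c : Fin 2, (prefers (B (c.natAdd 5)) x y).toNat := by
  have h : S.card = ∑ c : Fin (5 + 2),
      (if c.val < 5 then 1 else k) * (prefers (B c) x y).toNat := by
    have h₁ : S = Finset.univ.filter fun i => prefers (B (cls i)) x y = true := by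
      ext i
      simp [hS]
    rw [h₁, Finset.card_filter, ← Finset.sum_fiberwise Finset.univ cls]
    refine Finset.sum_congr rfl fun c _ => ?_
    rw [← hcls c, Finset.card_eq_sum_ones, Finset.sum_mul]
    refine Finset.sum_congr rfl fun i hi => ?_
    rw [(Finset.mem_filter.1 hi).2]
    cases prefers (B c) x y <;> simp
  rw [h, Fin.sum_univ_add, Finset.mul_sum]
  simp

theorem ne_unif_of_inadmissible (hf : IsDesirable f)
    (hcls : ∀ c, (Finset.univ.filter fun i => cls i = c).card = if c.val < 5 then 1 else k)
    {B : Blocks} {X : List (Fin 5)} (hX : X ∈ supports) (h : inadmissible B X = true) :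
    f (profile m fun i => B (cls i)) ≠ unif (coreSet hm X) := by
  intro hfX
  simp only [inadmissible, Bool.or_eq_true, List.any_eq_true, Bool.and_eq_true, bne_iff_ne,
    List.mem_finRange, true_and] at h
  rcases h with ⟨x, hx, hne⟩ | ⟨x, hx, y, hy⟩
  · have hcard := fun y z : Fin 5 =>
      card_prefers hcls B y z (S := Finset.univ.filter fun i =>
        (profile m (fun i => B (cls i)) i).rel (Fin.castLE hm y) (Fin.castLE hm z))
        fun i => Finset.mem_filter.trans (and_iff_right (Finset.mem_univ i))
    have hcw : CondorcetWinner (profile m fun i => B (cls i)) (Fin.castLE hm x) := by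
      intro z hz
      rcases lt_or_ge z.val 5 with hz5 | hz5
      · rw [show z = Fin.castLE hm ⟨z, hz5⟩ from rfl] at hz ⊢
        have hb := List.all_eq_true.1 hx ⟨z, hz5⟩ (List.mem_finRange _)
        rw [Bool.or_eq_true, beq_iff_eq] at hb
        replace hb := hb.resolve_left fun h => hz (congrArg (Fin.castLE hm) (Fin.ext h))
        rw [beats, Bool.and_eq_true, decide_eq_true_eq, decide_eq_true_eq] at hb
        rw [hcard, hcard]
        exact add_lt_add_of_lt_of_le hb.1 (Nat.mul_le_mul_left k hb.2)
      · have hall : ∀ i, (profile m (fun i => B (cls i)) i).rel (Fin.castLE hm x) z :=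
          fun i => prefers_of_lt_of_le _ x.isLt hz5
        obtain ⟨i, -⟩ := Finset.card_pos.1 ((hcls 0).trans_gt (by simp))
        rw [Finset.filter_false_of_mem fun i _ h =>
          StrictPref.irrefl _ _ (StrictPref.trans _ h (hall i)), Finset.card_empty]
        exact Finset.card_pos.2 ⟨i, Finset.mem_filter.2 ⟨Finset.mem_univ i, hall i⟩⟩
    have h₁ := hf.condorcet _ _ hcw
    rw [hfX, unif] at h₁
    split_ifs at h₁ with hmem
    · rw [card_coreSet hm (nodup_of_mem_supports hX), one_div, inv_eq_one, Nat.cast_eq_one,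
        List.length_eq_one_iff] at h₁
      obtain ⟨a, rfl⟩ := h₁
      rw [castLE_mem_coreSet, List.mem_singleton] at hmem
      exact hne (hmem ▸ rfl)
    · exact zero_ne_one h₁
  · have hd : ∀ i, (profile m (fun i => B (cls i)) i).rel (Fin.castLE hm y) (Fin.castLE hm x) :=
      fun i => List.all_eq_true.1 hy _ (List.mem_finRange (cls i))
    have h₁ := hf.exPost _ _ ⟨_, hd⟩
    have hmem := (castLE_mem_coreSet hm).2 hx
    rw [hfX, unif, if_pos hmem] at h₁
    exact one_div_ne_zero (Nat.cast_ne_zero.2 (Finset.card_ne_zero_of_mem hmem)) h₁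

theorem exists_mem_of_invariant (hf : IsDesirable f) {B : Blocks} {c : Fin 7} {T : Ballot}
    {C : List (List (Fin 5))} (hC : invariant B c T C = true) {X : List (Fin 5)}
    (hX : X ∈ supports) (hXC : X ∈ C)
    (hfX : f (profile m fun i => B (cls i)) = unif (coreSet hm X)) (S : Finset V)
    (hS : ∀ i ∈ S, cls i = c) :
    ∃ Y ∈ C, Y ∈ supports ∧
      f (profile m fun i => if i ∈ S then T else B (cls i)) = unif (coreSet hm Y) := by
  induction S using Finset.induction_on with
  | empty => exact ⟨X, hXC, hX, by simpa using hfX⟩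
  | insert i S hi ih =>
    obtain ⟨Z, hZC, hZ, hfZ⟩ := ih fun j hj => hS j (Finset.mem_insert_of_mem hj)
    obtain ⟨Y, hY, hfY, heff⟩ :=
      exists_support hm hf fun j => if j ∈ insert i S then T else B (cls j)
    refine ⟨Y, ?_, hY, hfY⟩
    have hcomp := compatible_of_eq_off hm hf (i := i) (fun j hj => ?_) hZ hY hfZ hfY
    · rw [if_neg hi, if_pos (Finset.mem_insert_self i S), hS i (Finset.mem_insert_self i S)]
        at hcomp
      have hsucc : Y ∈ successors (B c) T C := by
        rw [successors, List.mem_filter, List.any_eq_true]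
        exact ⟨hY, Z, hZC, hcomp⟩
      have := List.all_eq_true.1 hC Y hsucc
      rw [Bool.or_eq_true, List.contains_iff_mem] at this
      refine this.resolve_right ?_
      rw [Bool.not_eq_true', Bool.not_eq_false, efficient, List.all_eq_true]
      refine fun x hx => List.all_eq_true.2 fun y _ => ?_
      obtain ⟨j, hj⟩ := heff x hx y
      rw [Bool.not_eq_true', ← Bool.not_eq_true, Bool.and_eq_true]
      rintro ⟨hy, hyT⟩
      have hyB := List.all_eq_true.1 hy (cls j) (List.mem_finRange _)
      split_ifs at hj <;> simp_all
    · simp [hj]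

theorem ne_unif_of_check (hf : IsDesirable f)
    (hcls : ∀ c, (Finset.univ.filter fun i => cls i = c).card = if c.val < 5 then 1 else k)
    (t : Refutation) {B : Blocks} {X : List (Fin 5)} (hX : X ∈ supports)
    (ht : t.check B X = true) :
    f (profile m fun i => B (cls i)) ≠ unif (coreSet hm X) := by
  induction t generalizing B X with
  | leaf => exact ne_unif_of_inadmissible hm hf hcls hX ht
  | move c T next ih =>
    intro hfX
    rw [Refutation.check] at ht
    split_ifs at ht with hc
    · obtain ⟨Y, hY, hfY, -⟩ :=
        exists_support hm hf fun i => Function.update B c T (cls i)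
      obtain ⟨i, hi⟩ := Finset.card_eq_one.1 ((hcls c).trans (if_pos hc))
      have hiff : ∀ j, cls j = c ↔ j = i := fun j => by
        simpa using Finset.ext_iff.1 hi j
      refine ih Y hY (List.all_eq_true.1 ht Y ?_) hfY
      have hcomp := compatible_of_eq_off hm hf (i := i) (fun j hj => ?_) hX hY hfX hfY
      · rw [(hiff i).2 rfl, Function.update_self] at hcomp
        simpa [successors] using ⟨hY, hcomp⟩
      · rw [Function.update_of_ne (mt (hiff j).1 hj)]
    · simp only [Bool.and_eq_true, List.all_eq_true] at ht
      obtain ⟨Y, hYC, hY, hfY⟩ := exists_mem_of_invariant hm hf ht.1 hX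
        (by simp [Function.iterate_succ_apply']) hfX
        (Finset.univ.filter fun i => cls i = c) (by simp)
      refine ih Y hY (ht.2 Y hYC) ?_
      rw [← hfY]
      congr 2
      funext i
      by_cases hi : cls i = c <;> simp [hi]

end Soundness

/-- `5 + 2 * k` voters can be divided into five singletons and two classes of size `k`. -/
theorem exists_classes (k : ℕ) : ∃ cls : Fin (5 + 2 * k) → Fin 7,
    ∀ c, (Finset.univ.filter fun i => cls i = c).card = if c.val < 5 then 1 else k := by
  have e : Fin (5 + 2 * k) ≃ Σ c : Fin 7, Fin (if c.val < 5 then 1 else k) := by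
    refine Fintype.equivOfCardEq ?_
    rw [Fintype.card_sigma, Fintype.card_fin]
    simp only [Fintype.card_fin]
    simp [Fin.sum_univ_succ]
    ring
  refine ⟨fun i => (e i).1, fun c => ?_⟩
  rw [← Fintype.card_subtype, Fintype.card_congr ((e.subtypeEquiv fun _ => Iff.rfl).trans
    (Equiv.sigmaSubtype c)), Fintype.card_fin]

/-- Branching on the supports in a list; other supports should be inadmissible. -/
def branch (l : List (List (Fin 5) × Refutation)) (X : List (Fin 5)) : Refutation :=
  (l.lookup X).getD .leaf

/-- A profile for which no outcome is possible. -/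
def criticalBlocks : Blocks :=
  ![[0, 1, 2, 3, 4], [1, 0, 2, 4, 3], [2, 4, 3, 1, 0], [3, 1, 0, 2, 4], [3, 2, 4, 1, 0],
    [1, 0, 3, 2, 4], [2, 4, 3, 1, 0]]

/-- The derivations ruling out all outcomes of `criticalBlocks`. -/
def criticalRefutation : List (Fin 5) → Refutation := branch [
    ([0], .move 3 [0, 1, 2, 3, 4] (branch [])),
    ([1], .move 1 [4, 1, 3, 0, 2] (branch [])),
    ([0, 1], .move 3 [1, 3, 0, 2, 4] (branch [])),
    ([2], .move 3 [1, 2, 4, 0, 3] (branch [])),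
    ([0, 2], .move 3 [0, 1, 4, 3, 2] (branch [])),
    ([1, 2], .move 3 [1, 0, 4, 3, 2] (branch [])),
    ([0, 1, 2], .move 3 [1, 2, 0, 3, 4] (branch [])),
    ([3], .move 1 [4, 2, 1, 3, 0] (branch [])),
    ([0, 3], .move 2 [3, 2, 1, 4, 0] (branch [])),
    ([1, 3], .move 2 [3, 2, 1, 4, 0] (branch [])),
    ([0, 1, 3], .move 2 [3, 2, 4, 0, 1] (branch [])),
    ([2, 3], .move 1 [2, 4, 3, 0, 1] (branch [])),
    ([0, 2, 3], .move 1 [1, 2, 0, 3, 4] <| branch [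
      ([2], .move 3 [1, 3, 0, 4, 2] (branch [])),
      ([1, 3], .move 2 [3, 0, 4, 1, 2] (branch [])),
      ([2, 3], .move 1 [2, 3, 0, 1, 4] (branch [])),
      ([0, 2, 3], .move 1 [4, 2, 1, 3, 0] (branch []))]),
    ([1, 2, 3], .move 0 [0, 2, 1, 3, 4] <| branch [
      ([2], .move 5 [0, 2, 4, 3, 1] <| branch [
        ([2], .move 4 [2, 0, 3, 1, 4] <| branch [
          ([2], .move 3 [0, 2, 1, 3, 4] (branch []))])]),
      ([0, 3], .move 2 [3, 2, 1, 4, 0] (branch [])),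
      ([2, 3], .move 1 [2, 1, 0, 4, 3] (branch [])),
      ([1, 2, 3], .move 0 [4, 2, 3, 1, 0] (branch []))]),
    ([0, 1, 2, 3], .move 0 [1, 0, 4, 3, 2] <| branch [
      ([1], .move 2 [2, 3, 1, 0, 4] (branch [])),
      ([1, 2], .move 3 [1, 2, 0, 3, 4] (branch [])),
      ([3], .move 3 [3, 1, 4, 0, 2] <| branch [
        ([3], .move 5 [3, 0, 4, 2, 1] <| branch [
          ([3], .move 1 [4, 1, 2, 3, 0] (branch []))])]),
      ([1, 3], .move 2 [3, 1, 2, 4, 0] (branch [])),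
      ([1, 2, 3], .move 1 [0, 2, 1, 3, 4] (branch [])),
      ([4], .move 2 [4, 2, 1, 3, 0] (branch [])),
      ([1, 4], .move 3 [1, 0, 2, 4, 3] (branch [])),
      ([1, 2, 4], .move 3 [0, 1, 4, 2, 3] (branch [])),
      ([3, 4], .move 3 [3, 4, 0, 1, 2] <| branch [
        ([3, 4], .move 2 [4, 3, 2, 0, 1] <| branch [
          ([3, 4], .move 5 [3, 4, 1, 2, 0] (branch []))])]),
      ([1, 3, 4], .move 3 [3, 4, 1, 0, 2] <| branch [
        ([2, 3], .move 0 [3, 0, 1, 4, 2] (branch [])),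
        ([4], .move 3 [4, 2, 1, 0, 3] (branch [])),
        ([3, 4], .move 2 [4, 3, 2, 0, 1] <| branch [
          ([3, 4], .move 5 [3, 4, 1, 2, 0] (branch []))]),
        ([1, 3, 4], .move 2 [4, 1, 0, 3, 2] <| branch [
          ([1], .move 6 [4, 1, 0, 2, 3] (branch [])),
          ([1, 4], .move 5 [1, 0, 4, 2, 3] (branch [])),
          ([1, 3, 4], .move 6 [4, 1, 0, 3, 2] (branch []))])])])]

set_option maxRecDepth 100000 in
theorem check_criticalRefutation :
    (supports.all fun X => (criticalRefutation X).check criticalBlocks X) = true := by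
  decide +kernel

end EvenChance

/-- For `m ≥ 5` alternatives and an odd number `n ≥ 5` of voters, no even-chance SDS
on strict preference profiles satisfies weak strategyproofness, Condorcet-consistency,
and ex post efficiency simultaneously. -/
theorem no_evenChance_weakSP_condorcet_exPost (n m : ℕ)
    (hm : 5 ≤ m) (hn : 5 ≤ n) (hodd : Odd n) :
    ¬ ∃ f : (Fin n → StrictPref (Fin m)) → Fin m → ℝ,
        EvenChance f ∧ WeakSP f ∧ ExPostEfficient f ∧
        (∀ R x, CondorcetWinner R x → f R x = 1) := by
  rintro ⟨f, hE, hW, hX, hC⟩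
  obtain ⟨k, rfl⟩ : ∃ k, n = 5 + 2 * k := by
    obtain ⟨l, rfl⟩ := hodd
    exact ⟨l - 2, by omega⟩
  obtain ⟨cls, hcls⟩ := EvenChance.exists_classes k
  have hf : EvenChance.IsDesirable f := ⟨hE, hW, hX, hC⟩
  obtain ⟨X, hXs, hfX, -⟩ :=
    EvenChance.exists_support hm hf fun i => EvenChance.criticalBlocks (cls i)
  exact EvenChance.ne_unif_of_check hm hf hcls (EvenChance.criticalRefutation X) hXs
    (List.all_eq_true.1 EvenChance.check_criticalRefutation X hXs) hfX
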